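/- Let $\Omega \subset \mathbb{R}^2$ be a convex body (a compact convex set which is the closure of a bounded open connected set), let $d \ge 1$, and let $f \in C^{d,1}(\Omega)$, i.e. $f$ is $d$ times continuously differentiable on $\Omega$ with all partial derivatives of order $d$ Lipschitz continuous. Fix $\overline{P} \in \Omega$ and $h > 0$, set $\mathcal{N}_h = \overline{B}_h(\overline{P}) \cap \Omega$ where $\overline{B}_h(\overline{P})$ is the closed Euclidean ball of radius $h$ centered at $\overline{P}$, and let $X_d = \{\xi_1, \dots, \xi_{m_d}\} \subset \mathcal{N}_h$ with $m_d = (d+1)(d+2)/2$ be unisolvent for interpolation in $\mathbb{P}_d$ (the space of bivariate polynomials of total degree at most $d$), meaning the Vandermonde matrix $V_{h,d} = \big[ ((\xi_i - \overline{P})/h)^{\alpha} \big]_{1 \le i \le m_d,\ |\alpha| \le d}$ in the scaled monomial basis centered at $\overline{P}$ is invertible. Let $\pi_{h,d} \in \mathbb{P}_d$ be the unique polynomial with $\pi_{h,d}(\xi_i) = f(\xi_i)$ for $1 \le i \le m_d$. Then $|f(\overline{P}) - \pi_{h,d}(\overline{P})| \le \lambda_{h,d}(\overline{P}) \cdot \frac{2^d}{(d-1)!}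 \|f\|_{C^{d,1}(\mathcal{N}_h)} \cdot h^{d+1}$, where $\lambda_{h,d}(\overline{P})$ is the $\ell^1$-norm of the row of $V_{h,d}^{-1}$ indexed by the multi-index $\alpha = (0,0)$. -/

import Mathlib

open Metric

/-- The partial-derivative operator `D^α = ∂_x^{α₁} ∂_y^{α₂}` on functions on the
Euclidean plane, computed with derivatives within the set `Ω`. -/
noncomputable def pderivWithin (Ω : Set (EuclideanSpace ℝ (Fin 2))) (α : ℕ × ℕ)
    (f : EuclideanSpace ℝ (Fin 2) → ℝ) : EuclideanSpace ℝ (Fin 2) → ℝ :=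
  (fun g x => fderivWithin ℝ g Ω x (EuclideanSpace.single 0 1))^[α.1]
    ((fun g x => fderivWithin ℝ g Ω x (EuclideanSpace.single 1 1))^[α.2] f)

/-- The `C^{d,1}(K)` Hölder-type seminorm
`‖f‖ = sup { |D^α f(P) - D^α f(Q)| / ‖P - Q‖₂ : P, Q ∈ K, P ≠ Q, |α| = d }`,
with the derivatives taken within `Ω`. -/
noncomputable def holderSeminorm (Ω K : Set (EuclideanSpace ℝ (Fin 2))) (d : ℕ)
    (f : EuclideanSpace ℝ (Fin 2) → ℝ) : ℝ :=
  sSup {r | ∃ α : ℕ × ℕ, α.1 + α.2 = d ∧ ∃ P ∈ K, ∃ Q ∈ K, P ≠ Q ∧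
    r = |pderivWithin Ω α f P - pderivWithin Ω α f Q| / ‖P - Q‖}

section PartialDerivatives

variable {Ω : Set (EuclideanSpace ℝ (Fin 2))} {f : EuclideanSpace ℝ (Fin 2) → ℝ}

theorem pderivWithin_succ_fst (a b : ℕ) (x : EuclideanSpace ℝ (Fin 2)) :
    pderivWithin Ω (a + 1, b) f x =
      fderivWithin ℝ (pderivWithin Ω (a, b) f) Ω x (EuclideanSpace.single 0 1) := by
  simp only [pderivWithin, Function.iterate_succ_apply']

theorem contDiffOn_pderivWithin (hΩ : UniqueDiffOn ℝ Ω) {n : ℕ} (hf : ContDiffOn ℝ n f Ω)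
    {a b m : ℕ} (hm : a + b + m ≤ n) : ContDiffOn ℝ m (pderivWithin Ω (a, b) f) Ω := by
  have key : ∀ {g : EuclideanSpace ℝ (Fin 2) → ℝ} {k : ℕ} (e : EuclideanSpace ℝ (Fin 2)),
      ContDiffOn ℝ (k + 1 : ℕ) g Ω → ContDiffOn ℝ k (fun x => fderivWithin ℝ g Ω x e) Ω := by
    intro g k e hg
    exact (hg.fderivWithin hΩ (by norm_cast)).clm_apply contDiffOn_const
  induction a generalizing m with
  | zero =>
    induction b generalizing m with
    | zero => exact hf.of_le (by exact_mod_cast (by omega : m ≤ n))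
    | succ b ih =>
      have := key (EuclideanSpace.single 1 1) (ih (m := m + 1) (by omega))
      simpa only [pderivWithin, Function.iterate_succ_apply', Function.iterate_zero, id] using this
  | succ a ih =>
    have := key (EuclideanSpace.single 0 1) (ih (m := m + 1) (by omega))
    simpa only [pderivWithin, Function.iterate_succ_apply'] using this

/-- Second directional derivatives within a convex body commute. -/
theorem fderivWithin_fderivWithin_apply_comm (hconv : Convex ℝ Ω) (hint : (interior Ω).Nonempty)
    (hf : ContDiffOn ℝ 2 f Ω) {x : EuclideanSpace ℝ (Fin 2)} (hx : x ∈ Ω)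
    (v w : EuclideanSpace ℝ (Fin 2)) :
    fderivWithin ℝ (fun y => fderivWithin ℝ f Ω y v) Ω x w =
      fderivWithin ℝ (fun y => fderivWithin ℝ f Ω y w) Ω x v := by
  have hΩ := uniqueDiffOn_convex hconv hint
  have hd : DifferentiableWithinAt ℝ (fderivWithin ℝ f Ω) Ω x :=
    (hf.fderivWithin (m := 1) hΩ (by norm_num)).differentiableOn (by norm_num) x hx
  have happ : ∀ e : EuclideanSpace ℝ (Fin 2), fderivWithin ℝ (fun y => fderivWithin ℝ f Ω y e) Ω x =
      (fderivWithin ℝ (fderivWithin ℝ f Ω) Ω x).flip e := fun e => by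
    rw [fderivWithin_clm_apply (hΩ x hx) hd (differentiableWithinAt_const e)]
    simp
  have hcl : x ∈ closure (interior Ω) := by
    rw [hconv.closure_interior_eq_closure_of_nonempty_interior hint]
    exact subset_closure hx
  have hsymm := (hf x hx).isSymmSndFDerivWithinAt (by simp) hΩ hcl hx w v
  simpa [happ] using hsymm

theorem pderivWithin_succ_snd (hconv : Convex ℝ Ω) (hint : (interior Ω).Nonempty)
    {n : ℕ} (hf : ContDiffOn ℝ n f Ω) {a b : ℕ} (hab : a + b + 1 ≤ n)
    {x : EuclideanSpace ℝ (Fin 2)} (hx : x ∈ Ω) :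
    pderivWithin Ω (a, b + 1) f x =
      fderivWithin ℝ (pderivWithin Ω (a, b) f) Ω x (EuclideanSpace.single 1 1) := by
  have hΩ := uniqueDiffOn_convex hconv hint
  induction a generalizing x with
  | zero => simp only [pderivWithin, Function.iterate_succ_apply', Function.iterate_zero, id]
  | succ a ih =>
    have hcongr : ∀ y ∈ Ω, pderivWithin Ω (a, b + 1) f y =
        fderivWithin ℝ (pderivWithin Ω (a, b) f) Ω y (EuclideanSpace.single 1 1) :=
      fun y hy => ih (by omega) hy
    rw [pderivWithin_succ_fst, fderivWithin_congr hcongr (hcongr x hx),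
      fderivWithin_fderivWithin_apply_comm hconv hint
        (contDiffOn_pderivWithin hΩ hf (m := 2) (by omega)) hx]
    congr 2
    exact (funext fun y => pderivWithin_succ_fst a b y).symm

theorem hasDerivWithinAt_pderivWithin_segment (hconv : Convex ℝ Ω) (hint : (interior Ω).Nonempty)
    {n : ℕ} (hf : ContDiffOn ℝ n f Ω) {a b : ℕ} (hab : a + b + 1 ≤ n)
    {x u : EuclideanSpace ℝ (Fin 2)} {s : Set ℝ} (hs : ∀ t ∈ s, x + t • u ∈ Ω) {t : ℝ}
    (ht : t ∈ s) :
    HasDerivWithinAt (fun t : ℝ => pderivWithin Ω (a, b) f (x + t • u))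
      (u 0 * pderivWithin Ω (a + 1, b) f (x + t • u) +
        u 1 * pderivWithin Ω (a, b + 1) f (x + t • u)) s t := by
  have hΩ := uniqueDiffOn_convex hconv hint
  have hdiff := ((contDiffOn_pderivWithin hΩ hf (m := 1) hab).differentiableOn
    (by norm_num) _ (hs t ht)).hasFDerivWithinAt
  have hline : HasDerivWithinAt (fun t : ℝ => x + t • u) u s t := by
    simpa using (((hasDerivAt_id t).smul_const u).const_add x).hasDerivWithinAt
  have hu : ∀ L : EuclideanSpace ℝ (Fin 2) →L[ℝ] ℝ,
      L u = u 0 * L (EuclideanSpace.single 0 1) + u 1 * L (EuclideanSpace.single 1 1) := by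
    intro L
    have : u = u 0 • EuclideanSpace.single 0 1 + u 1 • EuclideanSpace.single 1 1 := by
      ext i
      fin_cases i <;> simp
    conv_lhs => rw [this]
    simp
  have := hdiff.comp_hasDerivWithinAt t hline hs
  rwa [hu, ← pderivWithin_succ_fst, ← pderivWithin_succ_snd hconv hint hf hab (hs t ht)] at this

/-- The binomial expansion of the `k`-th derivative of `t ↦ f (x + t • u)` in terms of the partial
derivatives of `f`. -/
noncomputable def lineDerivExpansion (Ω : Set (EuclideanSpace ℝ (Fin 2)))
    (f : EuclideanSpace ℝ (Fin 2) → ℝ) (u : EuclideanSpace ℝ (Fin 2)) (k : ℕ)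
    (y : EuclideanSpace ℝ (Fin 2)) : ℝ :=
  ∑ p ∈ Finset.HasAntidiagonal.antidiagonal k,
    (k.choose p.1 : ℝ) * (u 0 ^ p.1 * u 1 ^ p.2 * pderivWithin Ω p f y)

theorem hasDerivWithinAt_lineDerivExpansion (hconv : Convex ℝ Ω) (hint : (interior Ω).Nonempty)
    {n : ℕ} (hf : ContDiffOn ℝ n f Ω) {k : ℕ} (hk : k + 1 ≤ n)
    {x u : EuclideanSpace ℝ (Fin 2)} {s : Set ℝ} (hs : ∀ t ∈ s, x + t • u ∈ Ω) {t : ℝ}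
    (ht : t ∈ s) :
    HasDerivWithinAt (fun t : ℝ => lineDerivExpansion Ω f u k (x + t • u))
      (lineDerivExpansion Ω f u (k + 1) (x + t • u)) s t := by
  unfold lineDerivExpansion
  rw [Finset.sum_antidiagonal_choose_succ_mul
    (fun i j => u 0 ^ i * u 1 ^ j * pderivWithin Ω (i, j) f (x + t • u)), ← Finset.sum_add_distrib]
  refine HasDerivWithinAt.fun_sum fun p hp => ?_
  have hp' := Finset.HasAntidiagonal.mem_antidiagonal.1 hp
  have hterm := ((hasDerivWithinAt_pderivWithin_segment hconv hint hf (a := p.1) (b := p.2)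
    (by omega) hs ht).const_mul (u 0 ^ p.1 * u 1 ^ p.2)).const_mul (k.choose p.1 : ℝ)
  refine hterm.congr_deriv ?_
  rw [← Nat.choose_symm_of_eq_add hp'.symm]
  ring

theorem iteratedDerivWithin_segment (hconv : Convex ℝ Ω) (hint : (interior Ω).Nonempty)
    {n : ℕ} (hf : ContDiffOn ℝ n f Ω) {k : ℕ} (hk : k ≤ n)
    {x u : EuclideanSpace ℝ (Fin 2)} {s : Set ℝ} (hs : ∀ t ∈ s, x + t • u ∈ Ω)
    (hsu : UniqueDiffOn ℝ s) {t : ℝ} (ht : t ∈ s) :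
    iteratedDerivWithin k (fun t : ℝ => f (x + t • u)) s t =
      lineDerivExpansion Ω f u k (x + t • u) := by
  induction k generalizing t with
  | zero => simp [lineDerivExpansion, pderivWithin]
  | succ k ih =>
    rw [iteratedDerivWithin_succ]
    have hcongr : ∀ r ∈ s, iteratedDerivWithin k (fun t : ℝ => f (x + t • u)) s r =
        lineDerivExpansion Ω f u k (x + r • u) := fun r hr => ih (by omega) hr
    exact ((hasDerivWithinAt_lineDerivExpansion hconv hint hf hk hs ht).congr hcongr
      (hcongr t ht)).derivWithin (hsu t ht)

/-- Taylor formula with Lagrange remainder in a convex body. -/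
theorem exists_eq_sum_lineDerivExpansion (hconv : Convex ℝ Ω) (hint : (interior Ω).Nonempty)
    {n : ℕ} (hf : ContDiffOn ℝ (n + 1 : ℕ) f Ω) {x u : EuclideanSpace ℝ (Fin 2)}
    (hx : x ∈ Ω) (hxu : x + u ∈ Ω) :
    ∃ t ∈ Set.Ioo (0 : ℝ) 1, f (x + u) =
      ∑ k ∈ Finset.range (n + 1), lineDerivExpansion Ω f u k x / (k.factorial : ℝ) +
        lineDerivExpansion Ω f u (n + 1) (x + t • u) / ((n + 1).factorial : ℝ) := by
  have hs : ∀ t ∈ Set.Icc (0 : ℝ) 1, x + t • u ∈ Ω := fun t ht =>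
    hconv.add_smul_mem hx hxu ht
  have hsu : UniqueDiffOn ℝ (Set.Icc (0 : ℝ) 1) := uniqueDiffOn_Icc zero_lt_one
  have hg : ContDiffOn ℝ n (fun t : ℝ => f (x + t • u)) (Set.Icc 0 1) :=
    (hf.of_le (by exact_mod_cast n.le_succ)).comp (by fun_prop) hs
  have hg' : DifferentiableOn ℝ
      (iteratedDerivWithin n (fun t : ℝ => f (x + t • u)) (Set.Icc 0 1)) (Set.Ioo 0 1) := by
    intro t ht
    have ht' := Set.Ioo_subset_Icc_self ht
    have hcongr : ∀ r ∈ Set.Icc (0 : ℝ) 1,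
        iteratedDerivWithin n (fun t : ℝ => f (x + t • u)) (Set.Icc 0 1) r =
          lineDerivExpansion Ω f u n (x + r • u) :=
      fun r hr => iteratedDerivWithin_segment hconv hint hf (by omega) hs hsu hr
    exact (((hasDerivWithinAt_lineDerivExpansion hconv hint hf le_rfl hs ht').congr hcongr
      (hcongr t ht')).mono Set.Ioo_subset_Icc_self).differentiableWithinAt
  obtain ⟨t, ht, h⟩ := taylor_mean_remainder_lagrange (x₀ := (0 : ℝ)) (x := 1) (n := n)
    (f := fun t : ℝ => f (x + t • u)) zero_ne_one (by simpa using hg) (by simpa using hg')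
  rw [Set.uIcc_of_le zero_le_one, taylor_within_apply] at h
  rw [Set.uIoo_of_le zero_le_one] at ht
  refine ⟨t, ht, ?_⟩
  rw [iteratedDerivWithin_segment hconv hint hf le_rfl hs hsu (Set.Ioo_subset_Icc_self ht),
    sub_eq_iff_eq_add'] at h
  rw [one_smul] at h
  rw [h]
  congr 1
  · refine Finset.sum_congr rfl fun k hk => ?_
    rw [iteratedDerivWithin_segment hconv hint hf (Finset.mem_range.1 hk).le hs hsu (by simp)]
    simp [div_eq_inv_mul]
  · simp

theorem abs_lineDerivExpansion_sub_le {n : ℕ} {u y z : EuclideanSpace ℝ (Fin 2)} {M : ℝ}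
    (hM : ∀ p : ℕ × ℕ, p.1 + p.2 = n → |pderivWithin Ω p f y - pderivWithin Ω p f z| ≤ M) :
    |lineDerivExpansion Ω f u n y - lineDerivExpansion Ω f u n z| ≤ (2 * ‖u‖) ^ n * M := by
  have hM0 : 0 ≤ M := (abs_nonneg _).trans (hM (n, 0) (by simp))
  have hu : |u 0| + |u 1| ≤ 2 * ‖u‖ := by
    have h0 := PiLp.norm_apply_le u 0
    have h1 := PiLp.norm_apply_le u 1
    simp only [Real.norm_eq_abs] at h0 h1
    linarith
  calc |lineDerivExpansion Ω f u n y - lineDerivExpansion Ω f u n z|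
      ≤ ∑ p ∈ Finset.HasAntidiagonal.antidiagonal n,
          (n.choose p.1 : ℝ) * (|u 0| ^ p.1 * |u 1| ^ p.2 * M) := by
        unfold lineDerivExpansion
        rw [← Finset.sum_sub_distrib]
        refine (Finset.abs_sum_le_sum_abs _ _).trans (Finset.sum_le_sum fun p hp => ?_)
        rw [← mul_sub, ← mul_sub, abs_mul, abs_mul, abs_mul, abs_pow, abs_pow, Nat.abs_cast]
        gcongr
        exact hM p (Finset.HasAntidiagonal.mem_antidiagonal.1 hp)
    _ = (|u 0| + |u 1|) ^ n * M := by
        rw [(Commute.all |u 0| |u 1|).add_pow', Finset.sum_mul]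
        exact Finset.sum_congr rfl fun p _ => by rw [nsmul_eq_mul]; ring
    _ ≤ (2 * ‖u‖) ^ n * M := by gcongr

end PartialDerivatives

section Monomials

variable {ι : Type*} [Fintype ι] {d : ℕ} {α : ι → ℕ × ℕ}

/-- Summation over an enumeration of the bi-indices of length at most `d`, by total degree. -/
theorem sum_comp_eq_sum_antidiagonal (hinj : Function.Injective α)
    (hle : ∀ j, (α j).1 + (α j).2 ≤ d) (hsurj : ∀ β : ℕ × ℕ, β.1 + β.2 ≤ d → ∃ j, α j = β)
    (F : ℕ × ℕ → ℝ) :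
    ∑ j, F (α j) =
      ∑ k ∈ Finset.range (d + 1), ∑ p ∈ Finset.HasAntidiagonal.antidiagonal k, F p := by
  classical
  rw [← Finset.sum_biUnion, ← Finset.sum_image (s := Finset.univ) (g := α) fun _ _ _ _ h => hinj h]
  · refine Finset.sum_congr ?_ fun _ _ => rfl
    ext p
    simp only [Finset.mem_image, Finset.mem_univ, true_and, Finset.mem_biUnion, Finset.mem_range,
      Finset.HasAntidiagonal.mem_antidiagonal]
    constructor
    · rintro ⟨j, rfl⟩
      exact ⟨_, Nat.lt_succ_of_le (hle j), rfl⟩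
    · rintro ⟨k, hk, rfl⟩
      exact hsurj p (Nat.le_of_lt_succ hk)
  · intro k _ l _ hkl
    rw [Function.onFun, Finset.disjoint_left]
    intro p hp hp'
    rw [Finset.HasAntidiagonal.mem_antidiagonal] at hp hp'
    exact hkl (hp.symm.trans hp')

theorem MvPolynomial.add_le_of_mem_support {π : MvPolynomial (Fin 2) ℝ}
    (hπ : π.totalDegree ≤ d) {m : Fin 2 →₀ ℕ} (hm : m ∈ π.support) : m 0 + m 1 ≤ d := by
  have := (MvPolynomial.le_totalDegree hm).trans hπ
  rwa [Finsupp.sum_fintype _ _ fun _ => rfl, Fin.sum_univ_two] at this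

/-- A bivariate polynomial of total degree at most `d` is a combination of the monomials of degree
at most `d`. -/
theorem MvPolynomial.exists_eval_eq_sum_monomials (hinj : Function.Injective α)
    (hsurj : ∀ β : ℕ × ℕ, β.1 + β.2 ≤ d → ∃ j, α j = β)
    (π : MvPolynomial (Fin 2) ℝ) (hπ : π.totalDegree ≤ d) :
    ∃ c : ι → ℝ, ∀ y : Fin 2 → ℝ,
      MvPolynomial.eval y π = ∑ j, y 0 ^ (α j).1 * y 1 ^ (α j).2 * c j := by
  classical
  let e : ι → Fin 2 →₀ ℕ := fun j => Finsupp.equivFunOnFinite.symm ![(α j).1, (α j).2]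
  have he : Function.Injective e := by
    intro i j hij
    refine hinj (Prod.ext ?_ ?_)
    · simpa [e] using DFunLike.congr_fun hij 0
    · simpa [e] using DFunLike.congr_fun hij 1
  refine ⟨fun j => π.coeff (e j), fun y => ?_⟩
  rw [MvPolynomial.eval_eq']
  trans ∑ m ∈ Finset.univ.image e, π.coeff m * ∏ i, y i ^ m i
  · refine Finset.sum_subset (fun m hm => ?_) fun m _ hm => ?_
    · obtain ⟨j, hj⟩ := hsurj (m 0, m 1) (MvPolynomial.add_le_of_mem_support hπ hm)
      refine Finset.mem_image.2 ⟨j, Finset.mem_univ _, ?_⟩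
      ext i
      fin_cases i <;> simp [e, hj]
    · rw [MvPolynomial.notMem_support_iff.1 hm, zero_mul]
  · rw [Finset.sum_image fun _ _ _ _ h => he h]
    refine Finset.sum_congr rfl fun j _ => ?_
    simp [e, Fin.prod_univ_two, mul_comm]

/-- Affine rescaling of the variables does not increase the total degree. -/
theorem MvPolynomial.exists_eval_affine (π : MvPolynomial (Fin 2) ℝ) (hπ : π.totalDegree ≤ d)
    (h : ℝ) (x : Fin 2 → ℝ) :
    ∃ ρ : MvPolynomial (Fin 2) ℝ, ρ.totalDegree ≤ d ∧
      ∀ y : Fin 2 → ℝ, MvPolynomial.eval y ρ = MvPolynomial.eval (fun i => x i + h * y i) π := by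
  let L : Fin 2 → MvPolynomial (Fin 2) ℝ :=
    fun i => MvPolynomial.C (x i) + MvPolynomial.C h * MvPolynomial.X i
  have hL : ∀ i, (L i).totalDegree ≤ 1 := fun i =>
    (MvPolynomial.totalDegree_add _ _).trans <| max_le (by simp) <|
      (MvPolynomial.totalDegree_mul _ _).trans (by simp)
  refine ⟨∑ m ∈ π.support, MvPolynomial.C (π.coeff m) * ∏ i, L i ^ m i, ?_, fun y => ?_⟩
  · refine MvPolynomial.totalDegree_finsetSum_le fun m hm => ?_
    have hpow : ∀ i, (L i ^ m i).totalDegree ≤ m i := fun i =>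
      (MvPolynomial.totalDegree_pow _ _).trans (by simpa using Nat.mul_le_mul_left (m i) (hL i))
    refine (MvPolynomial.totalDegree_mul _ _).trans ?_
    rw [MvPolynomial.totalDegree_C, zero_add, Fin.prod_univ_two]
    exact (MvPolynomial.totalDegree_mul _ _).trans <| (add_le_add (hpow 0) (hpow 1)).trans
      (MvPolynomial.add_le_of_mem_support hπ hm)
  · simp [MvPolynomial.eval_eq' _ π, L]

end Monomials

theorem lineDerivExpansion_div_factorial {Ω : Set (EuclideanSpace ℝ (Fin 2))}
    {f : EuclideanSpace ℝ (Fin 2) → ℝ} {u x : EuclideanSpace ℝ (Fin 2)} (k : ℕ) :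
    lineDerivExpansion Ω f u k x / (k.factorial : ℝ) =
      ∑ p ∈ Finset.HasAntidiagonal.antidiagonal k, u 0 ^ p.1 * u 1 ^ p.2 *
        (pderivWithin Ω p f x / ((p.1.factorial : ℝ) * (p.2.factorial : ℝ))) := by
  rw [lineDerivExpansion, Finset.sum_div]
  refine Finset.sum_congr rfl fun p hp => ?_
  obtain rfl := Finset.HasAntidiagonal.mem_antidiagonal.1 hp
  have h := Nat.add_choose_mul_factorial_mul_factorial p.1 p.2
  rw [← h, Nat.choose_symm_add]
  have : ((p.1 + p.2).choose p.2 : ℝ) ≠ 0 := by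
    exact_mod_cast (Nat.choose_pos (Nat.le_add_left _ _)).ne'
  push_cast
  field_simp

/-- The degree-`n` Taylor remainder in a convex body, when the order-`n` partial derivatives vary by
at most `M` along the segment. -/
theorem abs_sub_sum_lineDerivExpansion_le {Ω : Set (EuclideanSpace ℝ (Fin 2))}
    {f : EuclideanSpace ℝ (Fin 2) → ℝ} (hconv : Convex ℝ Ω) (hint : (interior Ω).Nonempty)
    {d : ℕ} (hd : 1 ≤ d) (hf : ContDiffOn ℝ d f Ω) {x u : EuclideanSpace ℝ (Fin 2)}
    (hx : x ∈ Ω) (hxu : x + u ∈ Ω) {M : ℝ}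
    (hM : ∀ t ∈ Set.Ioo (0 : ℝ) 1, ∀ p : ℕ × ℕ, p.1 + p.2 = d →
      |pderivWithin Ω p f (x + t • u) - pderivWithin Ω p f x| ≤ M) :
    |f (x + u) - ∑ k ∈ Finset.range (d + 1), lineDerivExpansion Ω f u k x / (k.factorial : ℝ)| ≤
      (2 * ‖u‖) ^ d * M / (d.factorial : ℝ) := by
  obtain ⟨n, rfl⟩ := Nat.exists_eq_add_of_le' hd
  obtain ⟨t, ht, h⟩ := exists_eq_sum_lineDerivExpansion hconv hint hf hx hxu
  rw [h, Finset.sum_range_succ _ (n + 1), add_sub_add_left_eq_sub, ← sub_div, abs_div, Nat.abs_cast]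
  gcongr
  exact abs_lineDerivExpansion_sub_le (hM t ht)

/-- Pointwise error estimate for local polynomial interpolation on a convex body:
`|f(P̄) - π_{h,d}(P̄)| ≤ λ_{h,d}(P̄) · (2^d/(d-1)!) ‖f‖_{C^{d,1}(N_h)} · h^{d+1}`,
where `λ_{h,d}(P̄)` is the 1-norm of the row of the inverse scaled Vandermonde
matrix indexed by the multi-index `(0,0)`. -/
theorem pointwise_moving_interpolation_error
    (Ω : Set (EuclideanSpace ℝ (Fin 2)))
    (hΩc : IsCompact Ω) (hΩconv : Convex ℝ Ω) (hΩint : (interior Ω).Nonempty)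
    (d : ℕ) (hd : 1 ≤ d)
    (f : EuclideanSpace ℝ (Fin 2) → ℝ)
    (hf : ContDiffOn ℝ d f Ω)
    -- Lipschitz continuity of the order-`d` derivatives on `N_h = B̄_h(P̄) ∩ Ω`:
    (Pbar : EuclideanSpace ℝ (Fin 2)) (hPbar : Pbar ∈ Ω)
    (h : ℝ) (hh : 0 < h)
    (hLip : BddAbove {r | ∃ α : ℕ × ℕ, α.1 + α.2 = d ∧
      ∃ P ∈ closedBall Pbar h ∩ Ω, ∃ Q ∈ closedBall Pbar h ∩ Ω, P ≠ Q ∧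
        r = |pderivWithin Ω α f P - pderivWithin Ω α f Q| / ‖P - Q‖})
    -- the interpolation nodes `X_d ⊆ N_h`:
    (ξ : Fin ((d + 1) * (d + 2) / 2) → EuclideanSpace ℝ (Fin 2))
    (hξ : ∀ i, ξ i ∈ closedBall Pbar h ∩ Ω)
    -- an enumeration of the bivariate multi-indices of length at most `d`:
    (α : Fin ((d + 1) * (d + 2) / 2) → ℕ × ℕ)
    (hαinj : Function.Injective α)
    (hαle : ∀ j, (α j).1 + (α j).2 ≤ d)
    (hαsurj : ∀ β : ℕ × ℕ, β.1 + β.2 ≤ d → ∃ j, α j = β)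
    (i0 : Fin ((d + 1) * (d + 2) / 2)) (hi0 : α i0 = (0, 0))
    -- the Vandermonde matrix in the scaled monomial basis centered at `P̄`:
    (V : Matrix (Fin ((d + 1) * (d + 2) / 2)) (Fin ((d + 1) * (d + 2) / 2)) ℝ)
    (hV : V = Matrix.of fun i j =>
      ((ξ i 0 - Pbar 0) / h) ^ (α j).1 * ((ξ i 1 - Pbar 1) / h) ^ (α j).2)
    (hVdet : IsUnit V.det)
    -- the interpolating polynomial `π_{h,d} ∈ ℙ_d` of `f` at `X_d`:
    (π : MvPolynomial (Fin 2) ℝ) (hπdeg : π.totalDegree ≤ d)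
    (hπ : ∀ i, MvPolynomial.eval (ξ i) π = f (ξ i)) :
    |f Pbar - MvPolynomial.eval (Pbar : Fin 2 → ℝ) π| ≤
      (∑ i, |V⁻¹ i0 i|) *
        ((2 ^ d / (Nat.factorial (d - 1) : ℝ)) *
          holderSeminorm Ω (closedBall Pbar h ∩ Ω) d f) * h ^ (d + 1) := by
  set K := closedBall Pbar h ∩ Ω
  set L := holderSeminorm Ω K d f
  have hKconv : Convex ℝ K := (convex_closedBall Pbar h).inter hΩconv
  have hPK : Pbar ∈ K := ⟨mem_closedBall_self hh.le, hPbar⟩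
  have hL0 : 0 ≤ L := Real.sSup_nonneg (by rintro _ ⟨_, _, _, _, _, _, _, rfl⟩; positivity)
  have hLipK : ∀ p : ℕ × ℕ, p.1 + p.2 = d → ∀ y ∈ K,
      |pderivWithin Ω p f y - pderivWithin Ω p f Pbar| ≤ L * h := by
    intro p hp y hy
    rcases eq_or_ne y Pbar with rfl | hne
    · simpa using mul_nonneg hL0 hh.le
    · have hle : |pderivWithin Ω p f y - pderivWithin Ω p f Pbar| / ‖y - Pbar‖ ≤ L :=
        le_csSup hLip ⟨p, hp, y, hy, Pbar, hPK, hne, rfl⟩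
      rw [div_le_iff₀ (norm_pos_iff.2 (sub_ne_zero.2 hne))] at hle
      exact hle.trans (mul_le_mul_of_nonneg_left (mem_closedBall_iff_norm.1 hy.1) hL0)
  let D : ℕ × ℕ → ℝ := fun p =>
    pderivWithin Ω p f Pbar / ((p.1.factorial : ℝ) * (p.2.factorial : ℝ))
  let τ : Fin ((d + 1) * (d + 2) / 2) → ℝ := fun j => h ^ ((α j).1 + (α j).2) * D (α j)
  have hrem : ∀ i, |f (ξ i) - (V.mulVec τ) i| ≤
      2 ^ d / ((d - 1).factorial : ℝ) * L * h ^ (d + 1) := by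
    intro i
    have hVτ : (V.mulVec τ) i = ∑ k ∈ Finset.range (d + 1),
        lineDerivExpansion Ω f (ξ i - Pbar) k Pbar / (k.factorial : ℝ) := by
      simp only [lineDerivExpansion_div_factorial]
      rw [← sum_comp_eq_sum_antidiagonal hαinj hαle hαsurj, hV, Matrix.mulVec, dotProduct]
      refine Finset.sum_congr rfl fun j _ => ?_
      simp only [Matrix.of_apply, τ, D, PiLp.sub_apply, div_pow, pow_add]
      field_simp
    have hu : ‖ξ i - Pbar‖ ≤ h := mem_closedBall_iff_norm.1 (hξ i).1
    have hξi : Pbar + (ξ i - Pbar) = ξ i := add_sub_cancel _ _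
    have htaylor := abs_sub_sum_lineDerivExpansion_le hΩconv hΩint hd hf hPbar
      (u := ξ i - Pbar) (by rw [hξi]; exact (hξ i).2) (M := L * h) fun t ht p hp =>
        hLipK p hp _ (hKconv.add_smul_mem hPK (by rw [hξi]; exact hξ i)
          (Set.Ioo_subset_Icc_self ht))
    rw [hVτ]
    rw [hξi] at htaylor
    calc _ ≤ (2 * ‖ξ i - Pbar‖) ^ d * (L * h) / (d.factorial : ℝ) := htaylor
      _ ≤ (2 * h) ^ d * (L * h) / ((d - 1).factorial : ℝ) := by
        gcongr
        exact Nat.sub_le d 1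
      _ = _ := by ring
  obtain ⟨ρ, hρdeg, hρ⟩ := MvPolynomial.exists_eval_affine π hπdeg h Pbar
  obtain ⟨c, hc⟩ := MvPolynomial.exists_eval_eq_sum_monomials hαinj hαsurj ρ hρdeg
  have hVc : ∀ i, (V.mulVec c) i = f (ξ i) := by
    intro i
    have hy := hc fun k => (ξ i k - Pbar k) / h
    rw [hρ] at hy
    have hξi : (fun k => Pbar k + h * ((ξ i k - Pbar k) / h)) = ξ i := by
      funext k
      field_simp
      ring
    rw [hξi, hπ] at hy
    rw [hy, hV, Matrix.mulVec, dotProduct]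
    rfl
  have hindex : ∀ j, j ≠ i0 → (0 : ℝ) ^ (α j).1 * 0 ^ (α j).2 = 0 := by
    intro j hj
    have : ¬((α j).1 = 0 ∧ (α j).2 = 0) := fun hα =>
      hj (hαinj (by rw [hi0]; exact Prod.ext hα.1 hα.2))
    rw [not_and_or] at this
    rcases this with h' | h' <;> simp [h']
  have hc0 : MvPolynomial.eval (Pbar : Fin 2 → ℝ) π = c i0 := by
    have hy := hc 0
    rw [hρ, Finset.sum_eq_single i0 (fun j _ hj => by
      rw [Pi.zero_apply, Pi.zero_apply, hindex j hj, zero_mul]) (by simp)] at hy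
    simpa [hi0] using hy
  have hτ0 : f Pbar = τ i0 := by
    simp [τ, D, hi0, pderivWithin]
  have hinv : τ i0 - c i0 = ∑ i, V⁻¹ i0 i * ((V.mulVec τ) i - f (ξ i)) := by
    have hmul : V⁻¹.mulVec (V.mulVec (τ - c)) = τ - c := by
      rw [Matrix.mulVec_mulVec, Matrix.nonsing_inv_mul V hVdet, Matrix.one_mulVec]
    have := congrFun hmul i0
    rw [Matrix.mulVec_sub, Pi.sub_apply] at this
    rw [← this, Matrix.mulVec, dotProduct]
    simp only [Pi.sub_apply, hVc]
  rw [hτ0, hc0, hinv, mul_assoc, Finset.sum_mul]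
  refine (Finset.abs_sum_le_sum_abs _ _).trans (Finset.sum_le_sum fun i _ => ?_)
  rw [abs_mul, abs_sub_comm]
  exact mul_le_mul_of_nonneg_left (hrem i) (abs_nonneg _)
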